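/- Let Y = (y₁, y₂, y₃, y₄) ∈ ℝ⁴ with y₁² + y₂² ≠ y₃² + y₄². Then there exists a 4×4 real matrix B such that Bᵀη = −ηB (B ∈ so(2,2)), B·J₁ = J₁·B, B·J₂ = J₂·B, and B·Y = J₁·Y. -/

import Mathlib

open Matrix

noncomputable section

/-- `η = diag(1,1,−1,−1)`. -/
def η : Matrix (Fin 4) (Fin 4) ℝ := Matrix.diagonal ![1, 1, -1, -1]

/-- The Clifford map `J_{Z₁}` of the pseudo H-type Lie algebra `n_{0,2}`. -/
def J1 : Matrix (Fin 4) (Fin 4) ℝ :=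
  !![0,0,1,0;
     0,0,0,1;
     1,0,0,0;
     0,1,0,0]

/-- The Clifford map `J_{Z₂}` of the pseudo H-type Lie algebra `n_{0,2}`. -/
def J2 : Matrix (Fin 4) (Fin 4) ℝ :=
  !![0,0,0,1;
     0,0,-1,0;
     0,-1,0,0;
     1,0,0,0]

/-- For `Y = (y₁,y₂,y₃,y₄)` with `y₁² + y₂² ≠ y₃² + y₄²`, there is a matrix
`B ∈ so(2,2)` commuting with `J₁` and `J₂` such that `B·Y = J₁·Y`. -/
theorem statement16 (Y : Fin 4 → ℝ)
    (hY : (Y 0)^2 + (Y 1)^2 ≠ (Y 2)^2 + (Y 3)^2) :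
    ∃ B : Matrix (Fin 4) (Fin 4) ℝ,
      B.transpose * η = -(η * B) ∧
      B * J1 = J1 * B ∧
      B * J2 = J2 * B ∧
      B.mulVec Y = J1.mulVec Y := by
  obtain ⟨N, hN⟩ : ∃ N, N = (Y 0)^2 + (Y 1)^2 - (Y 2)^2 - (Y 3)^2 := ⟨_, rfl⟩
  have hN0 : N ≠ 0 := by
    intro h
    apply hY
    linarith
  obtain ⟨p, hp⟩ : ∃ p, p = -2 * (Y 3 * Y 0 - Y 2 * Y 1) / N := ⟨_, rfl⟩
  obtain ⟨a, ha⟩ : ∃ a, a = ((Y 0)^2 - (Y 1)^2 - (Y 2)^2 + (Y 3)^2) / N := ⟨_, rfl⟩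
  obtain ⟨b, hb⟩ : ∃ b, b = 2 * (Y 0 * Y 1 - Y 2 * Y 3) / N := ⟨_, rfl⟩
  have e0 : p * Y 1 + a * Y 2 + b * Y 3 = Y 2 := by
    rw [hp, ha, hb]; field_simp; rw [hN]; ring
  have e1 : -p * Y 0 + b * Y 2 - a * Y 3 = Y 3 := by
    rw [hp, ha, hb]; field_simp; rw [hN]; ring
  have e2 : a * Y 0 + b * Y 1 + p * Y 3 = Y 0 := by
    rw [hp, ha, hb]; field_simp; rw [hN]; ring
  have e3 : b * Y 0 - a * Y 1 - p * Y 2 = Y 1 := by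
    rw [hp, ha, hb]; field_simp; rw [hN]; ring
  refine ⟨!![0, p, a, b; -p, 0, b, -a; a, b, 0, p; b, -a, -p, 0], ?_, ?_, ?_, ?_⟩
  · ext i j
    fin_cases i <;> fin_cases j <;> simp [η, Matrix.mul_apply, Fin.sum_univ_four, Matrix.diagonal]
  · ext i j
    fin_cases i <;> fin_cases j <;> simp [J1, Matrix.mul_apply, Fin.sum_univ_four]
  · ext i j
    fin_cases i <;> fin_cases j <;> simp [J2, Matrix.mul_apply, Fin.sum_univ_four]
  · ext i
    fin_cases i <;> simp [J1, Matrix.mulVec, dotProduct, Fin.sum_univ_four] <;> linarith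

end
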